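/- Let m, n, d, p be integers with 1 ≤ m ≤ n, d ≥ 1 and p ≥ 1. If the Veronese–Koszul complex in n+1 variables at (i,q) is exact for all 1 ≤ i ≤ p and all q ≥ 2, then the Veronese–Koszul complex in m+1 variables at (i,q) is exact for all 1 ≤ i ≤ p and all q ≥ 2. (Equivalently: if the d-uple Veronese embedding of P^n satisfies property N_p, then so does the d-uple Veronese embedding of P^m.) -/

import Mathlib

open TensorProduct

noncomputable section

variable (K : Type*) [Field K]

/-- `S K n e` is the space of homogeneous polynomials of degree `e`
in the `n+1` variables `x_0, …, x_n`. -/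
abbrev S (n e : ℕ) : Submodule K (MvPolynomial (Fin (n + 1)) K) :=
  MvPolynomial.homogeneousSubmodule (Fin (n + 1)) K e

/-- The product of a homogeneous polynomial of degree `d` with one of degree `b`,
viewed as an element of degree `b + d`. -/
def mulSW {n d b : ℕ} (s : S K n d) (w : S K n b) : S K n (b + d) :=
  ⟨(s : MvPolynomial (Fin (n + 1)) K) * (w : MvPolynomial (Fin (n + 1)) K), by
    rw [MvPolynomial.mem_homogeneousSubmodule, Nat.add_comm b d]
    exact ((MvPolynomial.mem_homogeneousSubmodule _ _).1 s.2).mul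
      ((MvPolynomial.mem_homogeneousSubmodule _ _).1 w.2)⟩

/-- Identification of spaces of homogeneous polynomials of equal degrees. -/
def scast {n e₁ e₂ : ℕ} (h : e₁ = e₂) : S K n e₁ ≃ₗ[K] S K n e₂ :=
  LinearEquiv.ofEq _ _ (by rw [h])

/-- The increasing injection `Fin (a-1) → Fin a` omitting `j`. -/
def skipAt {a : ℕ} (j : Fin a) (i : Fin (a - 1)) : Fin a :=
  if (i : ℕ) < (j : ℕ) then ⟨i, by have := i.isLt; omega⟩
  else ⟨(i : ℕ) + 1, by have := i.isLt; omega⟩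

/-- The wedge `v 0 ∧ ⋯ ∧ v (a-1)` as an element of the `a`-th exterior power. -/
def wedge {M : Type*} [AddCommGroup M] [Module K M] (a : ℕ) (v : Fin a → M) :
    ⋀[K]^a M :=
  ⟨ExteriorAlgebra.ιMulti K a v, ExteriorAlgebra.ιMulti_range K a ⟨v, rfl⟩⟩

/-- `IsKoszulMap K n d a b δ` says that `δ : ⋀^a S_d ⊗ S_b → ⋀^{a-1} S_d ⊗ S_{b+d}` is
the Koszul map, i.e. it satisfies
`δ((s_1 ∧ ⋯ ∧ s_a) ⊗ w) = Σ_j (−1)^{j−1} (s_1 ∧ ⋯ ∧ ŝ_j ∧ ⋯ ∧ s_a) ⊗ (s_j·w)`. -/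
def IsKoszulMap (n d a b : ℕ)
    (δ : ((⋀[K]^a (S K n d)) ⊗[K] (S K n b)) →ₗ[K]
         ((⋀[K]^(a - 1) (S K n d)) ⊗[K] (S K n (b + d)))) : Prop :=
  ∀ (s : Fin a → S K n d) (w : S K n b),
    δ (wedge K a s ⊗ₜ[K] w) =
      ∑ j : Fin a, ((-1 : K) ^ (j : ℕ)) •
        ((wedge K (a - 1) fun i => s (skipAt j i)) ⊗ₜ[K] mulSW K (s j) w)

/-- Exactness of the Veronese–Koszul complex at `(i, q)`:
`ker δ_{i,qd} = im δ_{i+1,(q−1)d}` inside `⋀^i S_d ⊗ S_{qd}`. -/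
def VKExact (n d i q : ℕ) : Prop :=
  ∀ (h : (q - 1) * d + d = q * d)
    (δ₁ : ((⋀[K]^i (S K n d)) ⊗[K] (S K n (q * d))) →ₗ[K]
          ((⋀[K]^(i - 1) (S K n d)) ⊗[K] (S K n (q * d + d))))
    (δ₂ : ((⋀[K]^(i + 1) (S K n d)) ⊗[K] (S K n ((q - 1) * d))) →ₗ[K]
          ((⋀[K]^i (S K n d)) ⊗[K] (S K n ((q - 1) * d + d)))),
    IsKoszulMap K n d i (q * d) δ₁ → IsKoszulMap K n d (i + 1) ((q - 1) * d) δ₂ →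
    LinearMap.ker δ₁ =
      LinearMap.range
        ((TensorProduct.congr (LinearEquiv.refl K (⋀[K]^i (S K n d)))
            (scast K h)).toLinearMap ∘ₗ δ₂)

end

namespace VKAux

variable {K : Type*} [Field K]

/-- `mulSW` as a bilinear map. -/
noncomputable def mulL (n d b : ℕ) : S K n d →ₗ[K] S K n b →ₗ[K] S K n (b + d) :=
  LinearMap.mk₂ K (fun s w => mulSW K s w)
    (fun s t w => Subtype.ext (by simp [mulSW, add_mul]))
    (fun c s w => Subtype.ext (by simp [mulSW]))
    (fun s w v => Subtype.ext (by simp [mulSW, mul_add]))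
    (fun c s w => Subtype.ext (by simp [mulSW]))

/-- `s ↦ x ↦ w ↦ x ⊗ s w`. -/
noncomputable def G (n d k b : ℕ) : S K n d →ₗ[K] (⋀[K]^k (S K n d)) →ₗ[K] S K n b →ₗ[K]
    ((⋀[K]^k (S K n d)) ⊗[K] (S K n (b + d))) where
  toFun s := (LinearMap.lcomp K _ (mulL n d b s)) ∘ₗ (TensorProduct.mk K _ _)
  map_add' s t := by
    apply LinearMap.ext; intro x; apply LinearMap.ext; intro w
    simp [tmul_add]
  map_smul' c s := by
    apply LinearMap.ext; intro x; apply LinearMap.ext; intro w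
    simp

lemma exists_kos {M W N : Type*} [AddCommGroup M] [Module K M] [AddCommGroup W] [Module K W]
    [AddCommGroup N] [Module K N] (k : ℕ) (F : M →ₗ[K] (⋀[K]^k M) →ₗ[K] W →ₗ[K] N) :
    ∃ D : ((⋀[K]^(k + 1) M) ⊗[K] W) →ₗ[K] N, ∀ (s : Fin (k + 1) → M) (w : W),
      D (exteriorPower.ιMulti K (k + 1) s ⊗ₜ[K] w) =
        ∑ j : Fin (k + 1), ((-1 : K) ^ (j : ℕ)) •
          F (s j) (exteriorPower.ιMulti K k (j.removeNth s)) w := by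
  refine ⟨TensorProduct.lift (exteriorPower.alternatingMapLinearEquiv
    (AlternatingMap.alternatizeUncurryFin
      ((exteriorPower.alternatingMapLinearEquiv (R := K) (n := k)).symm.toLinearMap ∘ₗ F))), ?_⟩
  intro s w
  rw [TensorProduct.lift.tmul,
    exteriorPower.alternatingMapLinearEquiv_apply_ιMulti,
    AlternatingMap.alternatizeUncurryFin_apply, LinearMap.sum_apply]
  refine Finset.sum_congr rfl fun j _ => ?_
  rw [LinearMap.smul_apply]
  simp only [LinearMap.comp_apply, LinearEquiv.coe_coe,
    exteriorPower.alternatingMapLinearEquiv_symm_apply]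
  rcases Nat.even_or_odd (j : ℕ) with e | e <;> simp [e.neg_one_pow]

lemma wedge_eq {M : Type*} [AddCommGroup M] [Module K M] (a : ℕ) (v : Fin a → M) :
    wedge K a v = exteriorPower.ιMulti K a v := rfl

lemma skipAt_eq {k : ℕ} (j : Fin (k + 1)) (i : Fin k) :
    skipAt (a := k + 1) j i = j.succAbove i := by
  unfold skipAt Fin.succAbove
  simp only [Fin.lt_def, Fin.val_castSucc]
  split_ifs <;> rfl

lemma exists_isKoszul (n d k b : ℕ) : ∃ δ : ((⋀[K]^(k + 1) (S K n d)) ⊗[K] (S K n b)) →ₗ[K]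
    ((⋀[K]^k (S K n d)) ⊗[K] (S K n (b + d))), IsKoszulMap K n d (k + 1) b δ := by
  obtain ⟨D, hD⟩ := @exists_kos K _ (S K n d) (S K n b)
    ((⋀[K]^k (S K n d)) ⊗[K] (S K n (b + d))) _ _ _ _ TensorProduct.addCommGroup _ k (G n d k b)
  refine ⟨D, fun s w => (hD s w).trans (Finset.sum_congr rfl fun j _ => ?_)⟩
  have h1 : j.removeNth s = (fun i : Fin k => s (skipAt (a := k + 1) j i)) := by
    funext i; rw [skipAt_eq]; rfl
  rw [h1]
  rfl

/-- The Koszul map. -/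
noncomputable def kos (n d k b : ℕ) : ((⋀[K]^(k + 1) (S K n d)) ⊗[K] (S K n b)) →ₗ[K]
    ((⋀[K]^k (S K n d)) ⊗[K] (S K n (b + d))) := (exists_isKoszul n d k b).choose

lemma kos_isKoszul (n d k b : ℕ) : IsKoszulMap K n d (k + 1) b (kos n d k b) :=
  (exists_isKoszul n d k b).choose_spec

/-- A graded algebra map in degree `e`. -/
noncomputable def gmap {m n : ℕ}
    (φ : MvPolynomial (Fin (m + 1)) K →ₐ[K] MvPolynomial (Fin (n + 1)) K)
    (hφ : ∀ e, ∀ x ∈ S K m e, φ x ∈ S K n e) (e : ℕ) : S K m e →ₗ[K] S K n e :=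
  φ.toLinearMap.restrict (hφ e)

/-- The induced map on Koszul terms. -/
noncomputable def tmap {m n : ℕ}
    (φ : MvPolynomial (Fin (m + 1)) K →ₐ[K] MvPolynomial (Fin (n + 1)) K)
    (hφ : ∀ e, ∀ x ∈ S K m e, φ x ∈ S K n e) (d a b : ℕ) :
    ((⋀[K]^a (S K m d)) ⊗[K] (S K m b)) →ₗ[K] ((⋀[K]^a (S K n d)) ⊗[K] (S K n b)) :=
  TensorProduct.map (exteriorPower.map a (gmap φ hφ d)) (gmap φ hφ b)

lemma tmap_wedge {m n : ℕ}
    (φ : MvPolynomial (Fin (m + 1)) K →ₐ[K] MvPolynomial (Fin (n + 1)) K)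
    (hφ : ∀ e, ∀ x ∈ S K m e, φ x ∈ S K n e) (d a b : ℕ) (s : Fin a → S K m d) (w : S K m b) :
    tmap φ hφ d a b (wedge K a s ⊗ₜ[K] w) =
      wedge K a (fun i => gmap φ hφ d (s i)) ⊗ₜ[K] gmap φ hφ b w := by
  rw [tmap, TensorProduct.map_tmul, wedge_eq, exteriorPower.map_apply_ιMulti]
  rfl

lemma chain {m n : ℕ}
    (φ : MvPolynomial (Fin (m + 1)) K →ₐ[K] MvPolynomial (Fin (n + 1)) K)
    (hφ : ∀ e, ∀ x ∈ S K m e, φ x ∈ S K n e) (d a b : ℕ)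
    (δ : ((⋀[K]^a (S K m d)) ⊗[K] (S K m b)) →ₗ[K]
         ((⋀[K]^(a - 1) (S K m d)) ⊗[K] (S K m (b + d))))
    (δ' : ((⋀[K]^a (S K n d)) ⊗[K] (S K n b)) →ₗ[K]
         ((⋀[K]^(a - 1) (S K n d)) ⊗[K] (S K n (b + d))))
    (h : IsKoszulMap K m d a b δ) (h' : IsKoszulMap K n d a b δ') (x) :
    tmap φ hφ d (a - 1) (b + d) (δ x) = δ' (tmap φ hφ d a b x) := by
  have key : tmap φ hφ d (a - 1) (b + d) ∘ₗ δ = δ' ∘ₗ tmap φ hφ d a b := by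
    apply TensorProduct.ext
    refine LinearMap.ext_on (exteriorPower.ιMulti_span K a (S K m d)) ?_
    rintro _ ⟨s, rfl⟩
    apply LinearMap.ext; intro w
    change tmap φ hφ d (a - 1) (b + d) (δ (wedge K a s ⊗ₜ[K] w)) =
      δ' (tmap φ hφ d a b (wedge K a s ⊗ₜ[K] w))
    rw [h, tmap_wedge, h', map_sum]
    refine Finset.sum_congr rfl fun j _ => ?_
    rw [map_smul, tmap_wedge]
    congr 2
    apply Subtype.ext
    exact map_mul φ _ _
  exact LinearMap.congr_fun key x

lemma tmap_scast {m n : ℕ}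
    (φ : MvPolynomial (Fin (m + 1)) K →ₐ[K] MvPolynomial (Fin (n + 1)) K)
    (hφ : ∀ e, ∀ x ∈ S K m e, φ x ∈ S K n e) (d a b b' : ℕ) (h : b = b') (x) :
    tmap φ hφ d a b' (TensorProduct.congr (LinearEquiv.refl K (⋀[K]^a (S K m d))) (scast K h) x) =
      TensorProduct.congr (LinearEquiv.refl K (⋀[K]^a (S K n d))) (scast K h)
        (tmap φ hφ d a b x) := by
  subst h
  induction x with
  | zero => simp
  | add x y hx hy => simp only [map_add, hx, hy]
  | tmul x y => rfl

lemma tmap_retract {m n : ℕ}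
    (φ : MvPolynomial (Fin (m + 1)) K →ₐ[K] MvPolynomial (Fin (n + 1)) K)
    (hφ : ∀ e, ∀ x ∈ S K m e, φ x ∈ S K n e)
    (ψ : MvPolynomial (Fin (n + 1)) K →ₐ[K] MvPolynomial (Fin (m + 1)) K)
    (hψ : ∀ e, ∀ x ∈ S K n e, ψ x ∈ S K m e)
    (hr : ∀ x, ψ (φ x) = x) (d a b : ℕ) (x) :
    tmap ψ hψ d a b (tmap φ hφ d a b x) = x := by
  have hg : ∀ e, gmap ψ hψ e ∘ₗ gmap φ hφ e = LinearMap.id := fun e =>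
    LinearMap.ext fun x => Subtype.ext (hr x)
  have : tmap ψ hψ d a b ∘ₗ tmap φ hφ d a b = LinearMap.id := by
    rw [tmap, tmap, ← TensorProduct.map_comp, hg, ← exteriorPower.map_comp, hg,
      exteriorPower.map_id, TensorProduct.map_id]
  exact LinearMap.congr_fun this x

lemma descend {m n : ℕ}
    (φ : MvPolynomial (Fin (m + 1)) K →ₐ[K] MvPolynomial (Fin (n + 1)) K)
    (hφ : ∀ e, ∀ x ∈ S K m e, φ x ∈ S K n e)
    (ψ : MvPolynomial (Fin (n + 1)) K →ₐ[K] MvPolynomial (Fin (m + 1)) K)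
    (hψ : ∀ e, ∀ x ∈ S K n e, ψ x ∈ S K m e)
    (hr : ∀ x, ψ (φ x) = x) (d k q : ℕ) (hE : VKExact K n d (k + 1) q) :
    VKExact K m d (k + 1) q := by
  intro h δ₁ δ₂ h₁ h₂
  have E := hE h (kos n d k (q * d)) (kos n d (k + 1) ((q - 1) * d))
    (kos_isKoszul _ _ _ _) (kos_isKoszul _ _ _ _)
  have c₁ := chain φ hφ d (k + 1) (q * d) δ₁ _ h₁ (kos_isKoszul _ _ _ _)
  have c₂ := chain φ hφ d (k + 1 + 1) ((q - 1) * d) δ₂ _ h₂ (kos_isKoszul _ _ _ _)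
  have c₃ := chain ψ hψ d (k + 1 + 1) ((q - 1) * d) _ δ₂ (kos_isKoszul _ _ _ _) h₂
  apply le_antisymm
  · intro z hz
    have hz' : tmap φ hφ d (k + 1) (q * d) z ∈ LinearMap.ker (kos n d k (q * d)) := by
      rw [LinearMap.mem_ker] at hz ⊢
      exact (c₁ z).symm.trans (by rw [hz, map_zero])
    have hz2 := E.le hz'
    obtain ⟨y, hy⟩ := hz2
    refine ⟨tmap ψ hψ d (k + 1 + 1) ((q - 1) * d) y, ?_⟩
    have := congrArg (tmap ψ hψ d (k + 1) (q * d)) hy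
    rw [tmap_retract φ hφ ψ hψ hr] at this
    rw [← this]
    refine Eq.trans ?_ (tmap_scast ψ hψ d (k + 1) _ _ h _).symm
    exact congrArg (TensorProduct.congr (LinearEquiv.refl K (⋀[K]^(k + 1) (S K m d)))
      (scast K h)) (c₃ y).symm
  · rintro _ ⟨y, rfl⟩
    rw [LinearMap.mem_ker]
    have hE2 := E.ge ⟨tmap φ hφ d (k + 1 + 1) ((q - 1) * d) y, rfl⟩
    rw [LinearMap.mem_ker] at hE2
    rw [← tmap_retract φ hφ ψ hψ hr d (k + 1 - 1) (q * d + d) (δ₁ _), c₁]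
    refine Eq.trans (congrArg _ ?_) (map_zero (tmap ψ hψ d (k + 1 - 1) (q * d + d)))
    refine Eq.trans (congrArg _ ?_) hE2
    refine (tmap_scast φ hφ d (k + 1) _ _ h _).trans ?_
    exact congrArg (TensorProduct.congr (LinearEquiv.refl K (⋀[K]^(k + 1) (S K n d)))
      (scast K h)) (c₂ y)

end VKAux

/-- if the Veronese–Koszul complex in `n+1` variables is exact at `(i,q)` for all
`1 ≤ i ≤ p`, `q ≥ 2`, then so is the one in `m+1` variables, for `1 ≤ m ≤ n`
(property `N_p` descends from `P^n` to `P^m`). -/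
theorem stmt16 (K : Type*) [Field K] [CharZero K] (m n d p : ℕ)
    (hm : 1 ≤ m) (hmn : m ≤ n) (hd : 1 ≤ d) (hp : 1 ≤ p)
    (hexact : ∀ i, 1 ≤ i → i ≤ p → ∀ q, 2 ≤ q → VKExact K n d i q) :
    ∀ i, 1 ≤ i → i ≤ p → ∀ q, 2 ≤ q → VKExact K m d i q := by
  intro i hi hip q hq
  have hE := hexact i hi hip q hq
  obtain ⟨k, rfl⟩ : ∃ k, i = k + 1 := ⟨i - 1, by omega⟩
  let g : Fin (n + 1) → MvPolynomial (Fin (m + 1)) K := fun i =>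
    if h : (i : ℕ) < m + 1 then MvPolynomial.X ⟨i, h⟩ else 0
  have hg : ∀ i, (g i).IsHomogeneous 1 := by
    intro i
    simp only [g]
    split_ifs
    · exact MvPolynomial.isHomogeneous_X _ _
    · exact MvPolynomial.isHomogeneous_zero _ _ _
  refine VKAux.descend (MvPolynomial.rename (Fin.castLE (by omega))) ?_
    (MvPolynomial.aeval g) ?_ ?_ d k q hE
  · intro e x hx
    exact MvPolynomial.IsHomogeneous.rename_isHomogeneous hx
  · intro e x hx
    have := MvPolynomial.IsHomogeneous.aeval (S := K) hx g hg
    rw [one_mul] at this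
    exact this
  · intro x
    rw [MvPolynomial.aeval_rename]
    have : g ∘ (Fin.castLE (by omega) : Fin (m + 1) → Fin (n + 1)) = MvPolynomial.X := by
      funext j
      have hj : (j : ℕ) < m + 1 := j.isLt
      simp only [g, Function.comp_apply, Fin.val_castLE, dif_pos hj]
    rw [this, MvPolynomial.aeval_X_left_apply]
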